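/- If n ≡ 0 (mod 4), then the (n−2)-th determinantal divisor Δ_{n−2} of the walk matrix W(D_n) (the gcd of all (n−2)×(n−2) minors) divides 2^{n/2−1}; in fact the (n−2)×(n−2) minor of W(D_n) = [e, Ae, …, A^{n−1}e] obtained by deleting the first and last rows and the last two columns equals ±2^{n/2−1}. -/

import Mathlib

open Matrix

/-- Adjacency matrix of the Dynkin graph `D n`. -/
def dynkinAdj (n : ℕ) : Matrix (Fin n) (Fin n) ℤ :=
  Matrix.of fun i j =>
    if ((i.val + 1 = j.val ∧ 1 ≤ i.val) ∨ (j.val + 1 = i.val ∧ 1 ≤ j.val))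
        ∨ (i.val = 0 ∧ j.val = 2) ∨ (j.val = 0 ∧ i.val = 2) then 1 else 0

/-- The walk matrix `[e, Ae, …, A^{n-1}e]` of an `n × n` matrix. -/
def walkMatrix {n : ℕ} (A : Matrix (Fin n) (Fin n) ℤ) : Matrix (Fin n) (Fin n) ℤ :=
  Matrix.of fun i k => ((A ^ (k : ℕ)) *ᵥ (fun _ => 1)) i

/-- The adjacency operator of `D (N + 1)` on functions that agree on the two twin leaves: the twins
are folded into the single position `0`, and the remaining vertices are `1, …, N - 1`. -/
def foldedAdj (N : ℕ) : (ℕ → ℤ) →ₗ[ℤ] (ℕ → ℤ) where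
  toFun f t :=
    if N ≤ t then 0
    else (if t = 0 then 0 else if t = 1 then 2 * f 0 else f (t - 1)) +
      (if t + 1 < N then f (t + 1) else 0)
  map_add' f g := by
    funext t
    simp only [Pi.add_apply]
    split_ifs <;> ring
  map_smul' c f := by
    funext t
    simp only [Pi.smul_apply, smul_eq_mul, RingHom.id_apply]
    split_ifs <;> ring

lemma foldedAdj_apply (N : ℕ) (f : ℕ → ℤ) (t : ℕ) :
    foldedAdj N f t = if N ≤ t then 0
    else (if t = 0 then 0 else if t = 1 then 2 * f 0 else f (t - 1)) +
      (if t + 1 < N then f (t + 1) else 0) := rfl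

/-- The walk counts of length `k` in the folded graph. -/
def foldedWalk (N k : ℕ) : ℕ → ℤ := (foldedAdj N ^ k) fun t => if t < N then 1 else 0

lemma foldedWalk_zero (N t : ℕ) : foldedWalk N 0 t = if t < N then 1 else 0 := rfl

lemma foldedWalk_succ (N k : ℕ) : foldedWalk N (k + 1) = foldedAdj N (foldedWalk N k) := by
  simp only [foldedWalk, pow_succ', Module.End.mul_apply]

lemma dynkinAdj_mulVec (n : ℕ) (hn : 3 ≤ n) (f : ℕ → ℤ) (i : Fin n) :
    (dynkinAdj n *ᵥ fun j => f (j.val - 1)) i = foldedAdj (n - 1) f (i.val - 1) := by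
  obtain ⟨i, hi⟩ := i
  have key : (dynkinAdj n *ᵥ fun j => f (j.val - 1)) ⟨i, hi⟩ = ∑ j ∈ Finset.range n,
      ((if i - 1 = j then (if 2 ≤ i then f (j - 1) else 0) else 0) +
       (if i + 1 = j then (if 1 ≤ i then f (j - 1) else 0) else 0) +
       (if 2 = j then (if i = 0 then f (j - 1) else 0) else 0) +
       (if 0 = j then (if i = 2 then f (j - 1) else 0) else 0)) := by
    rw [Finset.sum_range]
    simp only [Matrix.mulVec, dotProduct]
    refine Finset.sum_congr rfl fun j _ => ?_
    simp only [dynkinAdj, Matrix.of_apply]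
    grind
  rw [key]
  simp only [Finset.sum_add_distrib, Finset.sum_ite_eq, Finset.mem_range, foldedAdj_apply]
  grind

lemma walkMatrix_dynkinAdj (n : ℕ) (hn : 3 ≤ n) (i k : Fin n) :
    walkMatrix (dynkinAdj n) i k = foldedWalk (n - 1) k.val (i.val - 1) := by
  have key : ∀ k : ℕ, (dynkinAdj n ^ k *ᵥ fun _ => (1 : ℤ)) =
      fun i : Fin n => foldedWalk (n - 1) k (i.val - 1) := by
    intro k
    induction k with
    | zero =>
      funext i
      have := i.isLt
      rw [foldedWalk_zero, if_pos (by omega)]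
      simp
    | succ k ih =>
      funext i
      rw [pow_succ', ← Matrix.mulVec_mulVec, ih, dynkinAdj_mulVec n hn, foldedWalk_succ]
  exact congrFun (key k) i

lemma sum_foldedAdj (N : ℕ) (f : ℕ → ℤ) (m : ℕ) (hm : m + 2 < N) :
    (2 : ℤ) ∣ ∑ t ∈ Finset.range (m + 2), foldedAdj N f t - f (m + 1) - f (m + 2) := by
  induction m with
  | zero =>
    refine ⟨f 0, ?_⟩
    simp only [Finset.sum_range_succ, Finset.sum_range_zero, foldedAdj_apply]
    grind
  | succ m ih =>
    obtain ⟨c, hc⟩ := ih (by omega)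
    refine ⟨c + f (m + 1), ?_⟩
    rw [Finset.sum_range_succ, foldedAdj_apply N f (m + 1 + 1)]
    grind

lemma foldedWalk_reflect (h k t : ℕ) (ht : 1 ≤ t) (ht' : t ≤ 2 * h) :
    (2 : ℤ) ∣ foldedWalk (2 * h + 1) k t - foldedWalk (2 * h + 1) k (2 * h + 1 - t) := by
  induction k generalizing t with
  | zero => simp only [foldedWalk_zero]; grind
  | succ k ih =>
    rw [foldedWalk_succ, foldedAdj_apply, foldedAdj_apply]
    have h1 : t + 1 ≤ 2 * h → _ := ih (t + 1) (by omega)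
    have h2 : 2 ≤ t → _ := fun h2 => ih (t - 1) (by omega) (by omega)
    have e1 : 2 * h + 1 - t - 1 = 2 * h + 1 - (t + 1) := by omega
    have e2 : 2 ≤ t → 2 * h + 1 - t + 1 = 2 * h + 1 - (t - 1) := by omega
    grind

lemma foldedWalk_sum_even (h k : ℕ) (hh : h % 2 = 1) :
    (2 : ℤ) ∣ ∑ t ∈ Finset.range (h + 1), foldedWalk (2 * h + 1) k t := by
  cases k with
  | zero =>
    have : ∑ t ∈ Finset.range (h + 1), foldedWalk (2 * h + 1) 0 t
        = ∑ t ∈ Finset.range (h + 1), 1 := by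
      refine Finset.sum_congr rfl fun t ht => ?_
      rw [Finset.mem_range] at ht
      rw [foldedWalk_zero, if_pos (by omega)]
    rw [this]
    simp
    omega
  | succ k =>
    rw [foldedWalk_succ]
    obtain ⟨m, rfl⟩ : ∃ m, h = m + 1 := ⟨h - 1, by omega⟩
    have h1 := sum_foldedAdj (2 * (m + 1) + 1) (foldedWalk (2 * (m + 1) + 1) k) m (by omega)
    have h2 := foldedWalk_reflect (m + 1) k (m + 1) (by omega) (by omega)
    rw [show 2 * (m + 1) + 1 - (m + 1) = m + 2 by omega] at h2
    rw [show m + 1 + 1 = m + 2 by omega]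
    omega

/-- A lower triangular basis, as columns, of the lattice of all `x : Fin (2 * h) → ℤ` with
`x t ≡ x (2 * h + 1 - t)` modulo `2` for `2 ≤ t ≤ h` and with `x 0 + ⋯ + x h` even. -/
def parityBasis (h : ℕ) : Matrix (Fin (2 * h)) (Fin (2 * h)) ℤ :=
  Matrix.of fun i j =>
    if i = j then (if i.val < h then 1 else 2)
    else if h ≤ i.val ∧ j.val < h ∧
        (i.val = h ∨ i.val = h + 1 ∨ i.val + j.val = 2 * h + 1) then 1 else 0

lemma det_parityBasis (h : ℕ) : (parityBasis h).det = 2 ^ h := by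
  rw [Matrix.det_of_isLowerTriangular]
  · have : ∀ i : Fin (2 * h), parityBasis h i i = (fun t : ℕ => if t < h then (1 : ℤ) else 2) i :=
      fun i => by simp [parityBasis]
    simp only [this]
    rw [Fin.prod_univ_eq_prod_range (fun t : ℕ => if t < h then (1 : ℤ) else 2), two_mul,
      Finset.prod_range_add]
    rw [Finset.prod_congr rfl (g := fun _ => (1 : ℤ)) fun t ht => by
      simp [Finset.mem_range.mp ht]]
    simp
  · intro i j hij
    have hij' : i.val < j.val := hij
    simp only [parityBasis, Matrix.of_apply]
    grind

/-- The square truncation of the folded walk matrix. -/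
def foldedWalkMatrix (h : ℕ) : Matrix (Fin (2 * h)) (Fin (2 * h)) ℤ :=
  Matrix.of fun i k => foldedWalk (2 * h + 1) k.val i.val

lemma exists_parityBasis_mulVec (h : ℕ) (x : ℕ → ℤ)
    (hx : ∀ t, 1 ≤ t → t ≤ 2 * h → (2 : ℤ) ∣ x t - x (2 * h + 1 - t))
    (hs : (2 : ℤ) ∣ ∑ t ∈ Finset.range (h + 1), x t) :
    ∃ y, parityBasis h *ᵥ y = fun i => x i.val := by
  obtain ⟨c, hc⟩ : ∃ c : ℕ → ℕ → ℤ, ∀ i j, c i j =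
      if h ≤ i ∧ j < h ∧ (i = h ∨ i = h + 1 ∨ i + j = 2 * h + 1) then 1 else 0 :=
    ⟨_, fun _ _ => rfl⟩
  obtain ⟨z, hzc⟩ : ∃ z : ℕ → ℤ, ∀ i, z i = ∑ j ∈ Finset.range (2 * h), c i j * x j :=
    ⟨_, fun _ => rfl⟩
  have hz : ∀ i, h ≤ i → i < 2 * h → (2 : ℤ) ∣ x i - z i := by
    intro i hi hi'
    have hsum : (i = h ∨ i = h + 1) → z i = ∑ t ∈ Finset.range h, x t := by
      intro hi2
      have hsub : Finset.range h ⊆ Finset.range (2 * h) := Finset.range_mono (by omega)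
      rw [hzc, ← Finset.sum_subset_zero_on_sdiff hsub (f := x) (g := fun j => c i j * x j)]
      · intro j hj
        simp only [Finset.mem_sdiff, Finset.mem_range] at hj
        simp only [hc]
        grind
      · intro j hj
        simp only [Finset.mem_range] at hj
        simp only [hc]
        grind
    rw [Finset.sum_range_succ] at hs
    by_cases h1 : i = h
    · rw [hsum (Or.inl h1)]; subst h1; omega
    by_cases h2 : i = h + 1
    · rw [hsum (Or.inr h2)]
      have := hx i (by omega) (by omega)
      rw [show 2 * h + 1 - i = h by omega] at this
      omega
    · have : z i = x (2 * h + 1 - i) := by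
        rw [hzc, Finset.sum_eq_single (2 * h + 1 - i)]
        · simp only [hc]; grind
        · intro j _ hj
          simp only [hc]; grind
        · intro hj
          simp only [Finset.mem_range] at hj
          omega
      rw [this]
      exact hx i (by omega) (by omega)
  refine ⟨fun i => if i.val < h then x i else (x i - z i) / 2, ?_⟩
  funext i
  have hsplit : ∀ j : Fin (2 * h),
      parityBasis h i j * (if j.val < h then x j else (x j - z j) / 2) =
      (if i = j then (if j.val < h then x j else 2 * ((x j - z j) / 2)) else 0) +
        (fun j : ℕ => c i j * x j) j := by
    intro j
    simp only [parityBasis, Matrix.of_apply, hc]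
    by_cases hij : i = j
    · subst hij
      by_cases hi : i.val < h
      · simp [hi, Nat.not_le.mpr hi]
      · simp [hi]
    · by_cases hj : j.val < h
      · simp [hij, hj]
      · simp [hij, hj]
  simp only [Matrix.mulVec, dotProduct, hsplit, Finset.sum_add_distrib, Finset.sum_ite_eq,
    Finset.mem_univ, if_true]
  rw [Fin.sum_univ_eq_sum_range (fun j : ℕ => c i j * x j), ← hzc]
  split_ifs with hi
  · have : z i = 0 := by
      rw [hzc]
      exact Finset.sum_eq_zero fun j _ => by simp only [hc]; grind
    omega
  · have := hz i (by omega) i.isLt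
    omega

/-- A matrix whose columns lie in the column lattice of `B` has determinant divisible by that of
`B`. -/
lemma det_dvd_det_of_mulVec {m : Type*} [Fintype m] [DecidableEq m] {R : Type*} [CommRing R]
    (A B : Matrix m m R) (H : ∀ j, ∃ y, B *ᵥ y = fun i => A i j) : B.det ∣ A.det := by
  choose y hy using H
  have : A = B * Matrix.of fun i j => y j i := by
    ext i j
    exact (congrFun (hy j) i).symm
  rw [this, Matrix.det_mul]
  exact dvd_mul_right _ _

lemma two_pow_dvd_det_foldedWalkMatrix (h : ℕ) (hh : h % 2 = 1) :
    2 ^ h ∣ (foldedWalkMatrix h).det := by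
  rw [← det_parityBasis]
  exact det_dvd_det_of_mulVec _ _ fun k =>
    exists_parityBasis_mulVec h _ (foldedWalk_reflect h k) (foldedWalk_sum_even h k hh)

/-- The vectors obtained from the walk vectors by Chebyshev-type recurrences. -/
def sparseVec (h l : ℕ) : ℕ → ℤ := fun t =>
  (if t = l then 1 else 0) - (if t = l + 1 then 1 else 0) +
    (if t + l = 2 * h + 1 ∧ 1 ≤ l then 1 else 0) + (if t + l = 2 * h then 1 else 0)

lemma sparseVec_zero (h : ℕ) (hh : 1 ≤ h) :
    sparseVec h 0 = (2 : ℤ) • foldedWalk (2 * h + 1) 0 - foldedWalk (2 * h + 1) 1 := by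
  funext t
  rw [foldedWalk_succ]
  simp only [sparseVec, Pi.sub_apply, Pi.smul_apply, smul_eq_mul, foldedAdj_apply, foldedWalk_zero]
  grind

lemma sparseVec_one (h : ℕ) (hh : 2 ≤ h) :
    sparseVec h 1 = foldedAdj (2 * h + 1) (sparseVec h 0) + sparseVec h 0 := by
  funext t
  simp only [sparseVec, Pi.add_apply, foldedAdj_apply]
  grind

lemma sparseVec_add_two (h l : ℕ) (hl : l + 2 ≤ 2 * h - 2) :
    sparseVec h (l + 2) = foldedAdj (2 * h + 1) (sparseVec h (l + 1)) - sparseVec h l := by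
  replace hl : l + 4 ≤ 2 * h := by omega
  funext t
  rcases t with _ | _ | t <;>
  · simp only [sparseVec, Pi.sub_apply, foldedAdj_apply]
    grind (splits := 30)

/-- The span of the walk vectors of length at most `m`. -/
def walkSpan (N m : ℕ) : Submodule ℤ (ℕ → ℤ) :=
  Submodule.span ℤ {f | ∃ k ≤ m, f = foldedWalk N k}

lemma walkSpan_mono (N : ℕ) {m m' : ℕ} (h : m ≤ m') : walkSpan N m ≤ walkSpan N m' :=
  Submodule.span_mono fun _ ⟨k, hk, hf⟩ => ⟨k, hk.trans h, hf⟩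

lemma foldedWalk_mem_walkSpan (N : ℕ) {k m : ℕ} (h : k ≤ m) : foldedWalk N k ∈ walkSpan N m :=
  Submodule.subset_span ⟨k, h, rfl⟩

lemma foldedAdj_mem_walkSpan (N m : ℕ) {f : ℕ → ℤ} (hf : f ∈ walkSpan N m) :
    foldedAdj N f ∈ walkSpan N (m + 1) := by
  have : walkSpan N m ≤ (walkSpan N (m + 1)).comap (foldedAdj N) := by
    refine Submodule.span_le.mpr ?_
    rintro _ ⟨k, hk, rfl⟩
    change foldedAdj N (foldedWalk N k) ∈ walkSpan N (m + 1)
    rw [← foldedWalk_succ]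
    exact foldedWalk_mem_walkSpan N (by omega)
  exact this hf

lemma sparseVec_mem_walkSpan (h l : ℕ) (hh : 1 ≤ h) (hl : l ≤ 2 * h - 2) :
    sparseVec h l ∈ walkSpan (2 * h + 1) (l + 1) := by
  induction l using Nat.twoStepInduction with
  | zero =>
    rw [sparseVec_zero h hh]
    exact sub_mem (Submodule.smul_mem _ _ (foldedWalk_mem_walkSpan _ (by omega)))
      (foldedWalk_mem_walkSpan _ (by omega))
  | one =>
    have h0 : sparseVec h 0 ∈ walkSpan (2 * h + 1) 1 := by
      rw [sparseVec_zero h hh]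
      exact sub_mem (Submodule.smul_mem _ _ (foldedWalk_mem_walkSpan _ (by omega)))
        (foldedWalk_mem_walkSpan _ (by omega))
    rw [sparseVec_one h (by omega)]
    exact add_mem (foldedAdj_mem_walkSpan _ _ h0) (walkSpan_mono _ (by omega) h0)
  | more l ih1 ih2 =>
    rw [sparseVec_add_two h l hl]
    exact sub_mem (foldedAdj_mem_walkSpan _ _ (ih2 (by omega)))
      (walkSpan_mono _ (by omega) (ih1 (by omega)))

/-- The defining relations of the cokernel of the truncated walk matrix, on the classes `ε t` of the
standard basis vectors. -/
structure WalkRelations {Q : Type*} [AddCommGroup Q] (h : ℕ) (ε : ℕ → Q) : Prop where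
  eq_zero : ∀ t, 2 * h ≤ t → ε t = 0
  sum : ∑ t ∈ Finset.range (2 * h), ε t = 0
  twin : ε 0 = ε 1
  step : ∀ l, 1 ≤ l → l ≤ 2 * h - 2 →
    ε l - ε (l + 1) + ε (2 * h + 1 - l) + ε (2 * h - l) = 0

namespace WalkRelations

variable {Q : Type*} [AddCommGroup Q] {h : ℕ} {ε : ℕ → Q}

lemma two_zsmul_reflect (H : WalkRelations h ε) (l : ℕ) (hl : 2 ≤ l) (hl' : l ≤ 2 * h - 2) :
    (2 : ℤ) • ε (2 * h - l) = -((2 : ℤ) • ε l) := by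
  have h1 := H.step l (by omega) hl'
  have h2 := H.step (2 * h - l) (by omega) (by omega)
  rw [show 2 * h - l + 1 = 2 * h + 1 - l by omega,
    show 2 * h + 1 - (2 * h - l) = l + 1 by omega, show 2 * h - (2 * h - l) = l by omega] at h2
  linear_combination (norm := module) h1 + h2

lemma two_zsmul_add_two (H : WalkRelations h ε) (l : ℕ) (hl : 2 ≤ l) (hl' : l + 2 ≤ 2 * h - 1) :
    (2 : ℤ) • ε (l + 2) = -((2 : ℤ) • ε l) := by
  have h1 := H.step (l + 1) (by omega) (by omega)
  have h2 := H.two_zsmul_reflect (l + 1) (by omega) (by omega)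
  have h3 := H.two_zsmul_reflect l hl (by omega)
  rw [show 2 * h + 1 - (l + 1) = 2 * h - l by omega, show l + 1 + 1 = l + 2 by omega] at h1
  linear_combination (norm := module) (-2 : ℤ) • h1 + h2 + h3

lemma two_zsmul_add_two_mul (H : WalkRelations h ε) (l : ℕ) (hl : 2 ≤ l)
    (h0 : (2 : ℤ) • ε l = 0) (j : ℕ) (hj : l + 2 * j ≤ 2 * h - 1) :
    (2 : ℤ) • ε (l + 2 * j) = 0 := by
  induction j with
  | zero => exact h0
  | succ j ih =>
    rw [show l + 2 * (j + 1) = l + 2 * j + 2 by ring,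
      H.two_zsmul_add_two _ (by omega) (by omega), ih (by omega), neg_zero]

lemma two_zsmul_odd (H : WalkRelations h ε) (hh : h % 2 = 1) (t : ℕ) (ht : t % 2 = 1)
    (ht3 : 3 ≤ t) (ht' : t ≤ 2 * h - 1) : (2 : ℤ) • ε t = 0 := by
  have hmid : (2 : ℤ) • ε h = 0 := by
    have := H.step h (by omega) (by omega)
    rw [show 2 * h + 1 - h = h + 1 by omega, show 2 * h - h = h by omega] at this
    linear_combination (norm := module) this
  have hup : ∀ s, h ≤ s → s % 2 = 1 → s ≤ 2 * h - 1 → (2 : ℤ) • ε s = 0 := by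
    intro s hs hs1 hs2
    have := H.two_zsmul_add_two_mul h (by omega) hmid ((s - h) / 2) (by omega)
    rwa [show h + 2 * ((s - h) / 2) = s by omega] at this
  rcases le_total h t with hle | hle
  · exact hup t hle ht ht'
  · have := H.two_zsmul_reflect t (by omega) (by omega)
    rw [hup (2 * h - t) (by omega) (by omega) (by omega)] at this
    exact neg_eq_zero.mp this.symm

lemma sum_Ico (H : WalkRelations h ε) {m : ℕ} (hm : h = 2 * m + 1) (j : ℕ) (hj : j ≤ m) :
    ∑ t ∈ Finset.Ico (2 * (m - j) + 2) (2 * m + 2 + 2 * j), ε t = 0 := by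
  induction j with
  | zero => simp
  | succ j ih =>
    have h1 := ih (by omega)
    have h2 := H.step (2 * (m - j)) (by omega) (by omega)
    have h3 := H.two_zsmul_odd (by omega) (2 * (m - j) + 1) (by omega) (by omega) (by omega)
    rw [show 2 * h + 1 - 2 * (m - j) = 2 * m + 2 + 2 * j + 1 by omega,
      show 2 * h - 2 * (m - j) = 2 * m + 2 + 2 * j by omega] at h2
    rw [show 2 * (m - (j + 1)) + 2 = 2 * (m - j) by omega,
      show 2 * m + 2 + 2 * (j + 1) = 2 * m + 2 + 2 * j + 1 + 1 by omega,
      Finset.sum_Ico_succ_top (by omega), Finset.sum_Ico_succ_top (by omega),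
      Finset.sum_eq_sum_Ico_succ_bot (by omega), Finset.sum_eq_sum_Ico_succ_bot (by omega), h1]
    linear_combination (norm := module) h2 + h3

lemma two_zsmul_zero (H : WalkRelations h ε) (hh : h % 2 = 1) : (2 : ℤ) • ε 0 = 0 := by
  obtain ⟨m, hm⟩ : ∃ m, h = 2 * m + 1 := ⟨h / 2, by omega⟩
  have h1 := H.sum_Ico hm m le_rfl
  have h2 := H.sum
  rw [Finset.range_eq_Ico, Finset.sum_eq_sum_Ico_succ_bot (by omega),
    Finset.sum_eq_sum_Ico_succ_bot (by omega)] at h2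
  rw [show 2 * (m - m) + 2 = 0 + 1 + 1 by omega,
    show 2 * m + 2 + 2 * m = 2 * h by omega] at h1
  rw [h1] at h2
  linear_combination (norm := module) h2 + H.twin

lemma two_zsmul (H : WalkRelations h ε) (hh : h % 2 = 1) (t : ℕ) : (2 : ℤ) • ε t = 0 := by
  have h0 := H.two_zsmul_zero hh
  have h1 : (2 : ℤ) • ε 1 = 0 := by rw [← H.twin, h0]
  by_cases ht : 2 * h ≤ t
  · rw [H.eq_zero t ht, smul_zero]
  by_cases ht0 : t = 0
  · rwa [ht0]
  by_cases ht1 : t = 1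
  · rwa [ht1]
  by_cases hodd : t % 2 = 1
  · exact H.two_zsmul_odd hh t hodd (by omega) (by omega)
  have h2 : (2 : ℤ) • ε 2 = 0 := by
    have a := H.step 1 le_rfl (by omega)
    have b := H.two_zsmul_odd hh (2 * h - 1) (by omega) (by omega) (by omega)
    have c := H.eq_zero (2 * h) le_rfl
    rw [show 2 * h + 1 - 1 = 2 * h by omega] at a
    linear_combination (norm := module) (-2 : ℤ) • a + b + (2 : ℤ) • c + h1
  have := H.two_zsmul_add_two_mul 2 le_rfl h2 ((t - 2) / 2) (by omega)
  rwa [show 2 + 2 * ((t - 2) / 2) = t by omega] at this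

lemma add_reflect (H : WalkRelations h ε) (hh : h % 2 = 1) (d : ℕ) (hd : d ≤ h) :
    ε (h - d) + ε (h + 1 + d) + ε h + ε (h + 1) = 0 := by
  induction d with
  | zero =>
    linear_combination (norm := module) H.two_zsmul hh h + H.two_zsmul hh (h + 1)
  | succ d ih =>
    have h1 := ih (by omega)
    by_cases hd0 : d + 1 = h
    · have a := H.eq_zero (h + 1 + d) (by omega)
      have b := H.eq_zero (h + 1 + (d + 1)) (by omega)
      have c := H.twin
      rw [show h - d = 1 by omega] at h1
      rw [show h - (d + 1) = 0 by omega]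
      linear_combination (norm := module) h1 + b - a + c
    · have a := H.step (h - (d + 1)) (by omega) (by omega)
      rw [show h - (d + 1) + 1 = h - d by omega,
        show 2 * h + 1 - (h - (d + 1)) = h + 1 + (d + 1) by omega,
        show 2 * h - (h - (d + 1)) = h + 1 + d by omega] at a
      have b := H.two_zsmul hh (h + 1 + d)
      linear_combination (norm := module) h1 + a - b

end WalkRelations

/-- The standard basis vectors of `Fin s → ℤ`, extended by zero. -/
def stdVec (s t : ℕ) : Fin s → ℤ := fun i => if i.val = t then 1 else 0

lemma walkRelations_foldedWalkMatrix (h : ℕ) (hh : 1 ≤ h) :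
    WalkRelations h fun t =>
      (LinearMap.range (foldedWalkMatrix h).mulVecLin).mkQ (stdVec (2 * h) t) := by
  set S := LinearMap.range (foldedWalkMatrix h).mulVecLin
  have hwalk : ∀ f ∈ walkSpan (2 * h + 1) (2 * h - 1), (fun i : Fin (2 * h) => f i.val) ∈ S := by
    intro f hf
    have hle : walkSpan (2 * h + 1) (2 * h - 1) ≤
        S.comap (LinearMap.funLeft ℤ ℤ (fun i : Fin (2 * h) => i.val)) := by
      refine Submodule.span_le.mpr ?_
      rintro _ ⟨k, hk, rfl⟩
      refine ⟨Pi.single ⟨k, by omega⟩ 1, ?_⟩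
      rw [Matrix.mulVecLin_apply, Matrix.mulVec_single_one]
      rfl
    exact hle hf
  have hsparse : ∀ l ≤ 2 * h - 2, (fun i : Fin (2 * h) => sparseVec h l i.val) ∈ S := fun l hl =>
    hwalk _ (walkSpan_mono _ (by omega) (sparseVec_mem_walkSpan h l hh hl))
  refine ⟨fun t ht => ?_, ?_, ?_, fun l hl hl' => ?_⟩
  · have : stdVec (2 * h) t = 0 := by
      funext i
      have := i.isLt
      exact if_neg (by omega)
    rw [this, map_zero]
  · rw [← map_sum, Submodule.mkQ_apply, Submodule.Quotient.mk_eq_zero]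
    convert hwalk _ (foldedWalk_mem_walkSpan (2 * h + 1) (Nat.zero_le _)) using 1
    funext i
    have := i.isLt
    simp only [stdVec, Finset.sum_apply, Finset.sum_ite_eq, Finset.mem_range, foldedWalk_zero]
    grind
  · rw [← sub_eq_zero, ← map_sub, Submodule.mkQ_apply, Submodule.Quotient.mk_eq_zero]
    convert hsparse 0 (by omega) using 1
    funext i
    have := i.isLt
    simp only [stdVec, sparseVec, Pi.sub_apply]
    grind
  · rw [← map_sub, ← map_add, ← map_add, Submodule.mkQ_apply, Submodule.Quotient.mk_eq_zero]
    convert hsparse l hl' using 1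
    funext i
    have := i.isLt
    simp only [stdVec, sparseVec, Pi.sub_apply, Pi.add_apply]
    grind

lemma det_foldedWalkMatrix_dvd (h : ℕ) (hh : h % 2 = 1) :
    (foldedWalkMatrix h).det ∣ 2 ^ h := by
  rw [← det_parityBasis]
  refine det_dvd_det_of_mulVec _ _ fun j => ?_
  have H := walkRelations_foldedWalkMatrix h (by omega)
  have := j.isLt
  change (fun i => parityBasis h i j) ∈ LinearMap.range (foldedWalkMatrix h).mulVecLin
  rw [← Submodule.Quotient.mk_eq_zero, ← Submodule.mkQ_apply]
  by_cases hj : j.val < h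
  · have key := H.add_reflect hh (h - j.val) (by omega)
    simp only [← map_add] at key
    convert key using 2
    funext i
    have := i.isLt
    simp only [stdVec, parityBasis, Matrix.of_apply, Pi.add_apply, Fin.ext_iff]
    grind
  · have key := H.two_zsmul hh j.val
    simp only [← map_smul] at key
    convert key using 2
    funext i
    simp only [stdVec, parityBasis, Matrix.of_apply, Pi.smul_apply, Fin.ext_iff, smul_eq_mul]
    grind

lemma det_foldedWalkMatrix (h : ℕ) (hh : h % 2 = 1) :
    (foldedWalkMatrix h).det = 2 ^ h ∨ (foldedWalkMatrix h).det = -2 ^ h :=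
  Int.associated_iff.mp
    (associated_of_dvd_dvd (det_foldedWalkMatrix_dvd h hh) (two_pow_dvd_det_foldedWalkMatrix h hh))

lemma det_walkMatrix_submatrix (n : ℕ) (h4 : n % 4 = 0) (hn : 4 ≤ n)
    (r c : Fin (n - 2) → Fin n) (hr : ∀ i, (r i).val = i.val + 1) (hc : ∀ i, (c i).val = i.val) :
    ((walkMatrix (dynkinAdj n)).submatrix r c).det = (foldedWalkMatrix (n / 2 - 1)).det := by
  have hs : n - 2 = 2 * (n / 2 - 1) := by omega
  rw [← Matrix.det_submatrix_equiv_self (finCongr hs)]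
  congr 1
  ext i k
  rw [Matrix.submatrix_apply, walkMatrix_dynkinAdj n (by omega), hr, hc]
  simp only [Matrix.submatrix_apply, foldedWalkMatrix, Matrix.of_apply, finCongr_apply,
    Fin.val_cast, Nat.add_sub_cancel]
  congr 1
  omega

theorem stmt19 (n : ℕ) (h4 : n % 4 = 0) (hn : 4 ≤ n) :
    (∀ d : ℤ,
        (∀ (r c : Fin (n - 2) → Fin n), Function.Injective r → Function.Injective c →
          d ∣ ((walkMatrix (dynkinAdj n)).submatrix r c).det) →
        d ∣ 2 ^ (n / 2 - 1))
    ∧ (((walkMatrix (dynkinAdj n)).submatrix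
          (fun i : Fin (n - 2) => (⟨i.val + 1, by have := i.isLt; omega⟩ : Fin n))
          (fun i : Fin (n - 2) => (⟨i.val, by have := i.isLt; omega⟩ : Fin n))).det
          = 2 ^ (n / 2 - 1)
        ∨ ((walkMatrix (dynkinAdj n)).submatrix
          (fun i : Fin (n - 2) => (⟨i.val + 1, by have := i.isLt; omega⟩ : Fin n))
          (fun i : Fin (n - 2) => (⟨i.val, by have := i.isLt; omega⟩ : Fin n))).det
          = -2 ^ (n / 2 - 1)) := by
  have hodd : (n / 2 - 1) % 2 = 1 := by omega
  refine ⟨fun d hd => ?_, ?_⟩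
  · refine (hd (fun i => ⟨i.val + 1, by have := i.isLt; omega⟩)
      (fun i => ⟨i.val, by have := i.isLt; omega⟩) ?_ ?_).trans ?_
    · intro i j hij
      simpa [Fin.ext_iff] using hij
    · intro i j hij
      simpa [Fin.ext_iff] using hij
    · rw [det_walkMatrix_submatrix n h4 hn _ _ (fun _ => rfl) (fun _ => rfl)]
      exact det_foldedWalkMatrix_dvd _ hodd
  · rw [det_walkMatrix_submatrix n h4 hn _ _ (fun _ => rfl) (fun _ => rfl)]
    exact det_foldedWalkMatrix _ hodd
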